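/- arXiv:math/9809125 — 2 statements merged into one kernel-verified Lean document; each statement's English description precedes it below -/
import Mathlib

section
/- Define P_n(x) = ∑_{k=0}^{n} (-1)^k · C(n,k) · C(n+k,k) · ((1-x)/2)^k for natural numbers n and real x. Then for every natural number n and every real number x, P_{n+1}(x) - P_n(x) = (x + xn - 1 - n) · ∑_{k=0}^{n} [(-n)_k · (n+2)_k / ((2)_k · k!)] · ((1-x)/2)^k; i.e., the difference of successive Legendre polynomials equals (n+1)(x-1) · ₂F₁(-n, n+2; 2; (1-x)/2). -/
/-- The Legendre polynomial `P_n(x) = ∑_{k=0}^{n} (-1)^k C(n,k) C(n+k,k) ((1-x)/2)^k`. -/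
noncomputable def legendreP (n : ℕ) (x : ℝ) : ℝ :=
  ∑ k ∈ Finset.range (n + 1),
    (-1 : ℝ) ^ k * (n.choose k : ℝ) * ((n + k).choose k : ℝ) * ((1 - x) / 2) ^ k

/-- The Pochhammer symbol (rising factorial) `(y)_k = ∏_{j=0}^{k-1} (y+j)`. -/
def poch (y : ℝ) (k : ℕ) : ℝ :=
  ∏ j ∈ Finset.range k, (y + j)

theorem poch_succ (y : ℝ) (k : ℕ) : poch y (k + 1) = poch y k * (y + k) :=
  Finset.prod_range_succ _ _

theorem poch_succ_left (y : ℝ) (k : ℕ) : poch y (k + 1) = y * poch (y + 1) k := by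
  unfold poch
  rw [Finset.prod_range_succ', mul_comm]
  push_cast
  simp only [add_zero, add_assoc, add_comm (1 : ℝ)]

theorem poch_neg_natCast (n k : ℕ) :
    poch (-(n : ℝ)) k = (-1) ^ k * (n.choose k : ℝ) * (k.factorial : ℝ) := by
  induction k with
  | zero => simp [poch]
  | succ k ih =>
    have h : (n.choose (k + 1) : ℝ) * (k + 1) = n.choose k * (n - k) := by
      rcases le_or_gt k n with hk | hk
      · have := Nat.choose_succ_right_eq n k
        rw [← Nat.cast_sub hk]
        exact_mod_cast this
      · simp [Nat.choose_eq_zero_of_lt hk, Nat.choose_eq_zero_of_lt (hk.trans k.lt_succ_self)]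
    rw [poch_succ, ih, Nat.factorial_succ]
    push_cast
    linear_combination (-1 : ℝ) ^ k * (k.factorial : ℝ) * h

theorem poch_natCast (n k : ℕ) : poch (n : ℝ) k = (n.ascFactorial k : ℝ) := by
  induction k with
  | zero => simp [poch]
  | succ k ih =>
    rw [poch_succ, ih, Nat.ascFactorial_succ]
    push_cast
    ring

theorem poch_natCast_add_one (n k : ℕ) :
    poch ((n : ℝ) + 1) k = (k.factorial : ℝ) * ((n + k).choose k : ℝ) := by
  have h := poch_natCast (n + 1) k
  rw [Nat.ascFactorial_eq_factorial_mul_choose] at h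
  exact_mod_cast h

theorem poch_two (k : ℕ) : poch 2 k = ((k + 1).factorial : ℝ) := by
  have h := poch_natCast_add_one 1 k
  rw [add_comm 1 k, Nat.choose_succ_self_right] at h
  rw [Nat.factorial_succ, ← one_add_one_eq_two]
  push_cast at h ⊢
  rw [h, mul_comm]

theorem legendre_coeff_eq_poch (n k : ℕ) :
    (-1 : ℝ) ^ k * (n.choose k : ℝ) * ((n + k).choose k : ℝ) =
      poch (-(n : ℝ)) k * poch ((n : ℝ) + 1) k / (k.factorial : ℝ) ^ 2 := by
  rw [poch_neg_natCast, poch_natCast_add_one]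
  have := Nat.cast_ne_zero (R := ℝ).mpr k.factorial_ne_zero
  field_simp

/-- The coefficientwise form of the difference formula for successive Legendre polynomials. -/
theorem legendre_coeff_succ_sub (n k : ℕ) :
    (-1 : ℝ) ^ (k + 1) * ((n + 1).choose (k + 1) : ℝ) * ((n + 1 + (k + 1)).choose (k + 1) : ℝ) -
        (-1 : ℝ) ^ (k + 1) * (n.choose (k + 1) : ℝ) * ((n + (k + 1)).choose (k + 1) : ℝ) =
      -2 * ((n : ℝ) + 1) * (poch (-(n : ℝ)) k * poch ((n : ℝ) + 2) k /
        (poch 2 k * (k.factorial : ℝ))) := by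
  rw [legendre_coeff_eq_poch, legendre_coeff_eq_poch, poch_two,
    poch_succ_left (-((n + 1 : ℕ) : ℝ)), poch_succ (((n + 1 : ℕ) : ℝ) + 1),
    poch_succ (-(n : ℝ)), poch_succ_left ((n : ℝ) + 1), Nat.factorial_succ]
  push_cast
  have h₁ : -((n : ℝ) + 1) + 1 = -n := by ring
  have h₂ : (n : ℝ) + 1 + 1 = n + 2 := by ring
  rw [h₁, h₂]
  have := Nat.cast_ne_zero (R := ℝ).mpr k.factorial_ne_zero
  have : (k : ℝ) + 1 ≠ 0 := by positivity
  field_simp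
  ring

/-- The difference of successive Legendre polynomials equals
`(x + xn - 1 - n) · ₂F₁(-n, n+2; 2; (1-x)/2)`. -/
theorem legendre_successive_difference (n : ℕ) (x : ℝ) :
    legendreP (n + 1) x - legendreP n x =
      (x + x * n - 1 - n) * ∑ k ∈ Finset.range (n + 1),
        (poch (-(n : ℝ)) k * poch ((n : ℝ) + 2) k /
          (poch 2 k * (Nat.factorial k : ℝ))) * ((1 - x) / 2) ^ k := by
  have h : legendreP n x = ∑ k ∈ Finset.range (n + 1 + 1),
      (-1 : ℝ) ^ k * (n.choose k : ℝ) * ((n + k).choose k : ℝ) * ((1 - x) / 2) ^ k := by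
    rw [Finset.sum_range_succ _ (n + 1), Nat.choose_succ_self]
    simp [legendreP]
  rw [h, legendreP, ← Finset.sum_sub_distrib, Finset.sum_range_succ', Finset.mul_sum]
  simp only [pow_zero, Nat.choose_zero_right, sub_self, add_zero]
  refine Finset.sum_congr rfl fun k _ => ?_
  rw [← sub_mul, legendre_coeff_succ_sub]
  ring
end

section
/- Let n be a natural number, let b, x be real numbers, and let c, d be real numbers with c > 0 and d > 0. Then ∫_0^1 t^{c-1} (1-t)^{d-1} · (∑_{k=0}^{n} [(-n)_k (b)_k / ((c)_k · k!)] · (t x)^k) dt = (Γ(c) Γ(d) / Γ(c+d)) · ∑_{k=0}^{n} [(-n)_k (b)_k / ((c+d)_k · k!)] · x^k (Bateman's integral representation, terminating case). -/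
theorem Gamma_add_natCast_eq_poch_mul_Gamma {y : ℝ} (hy : 0 < y) (k : ℕ) :
    Real.Gamma (y + k) = poch y k * Real.Gamma y := by
  induction k with
  | zero => simp [poch]
  | succ k ih =>
    have hyk : y + k ≠ 0 := by positivity
    rw [Nat.cast_succ, ← add_assoc, Real.Gamma_add_one hyk, ih, poch, poch,
      Finset.prod_range_succ]
    ring

theorem poch_pos {y : ℝ} (hy : 0 < y) (k : ℕ) : 0 < poch y k :=
  Finset.prod_pos fun _ _ => by positivity

theorem ofReal_rpow_mul_one_sub_rpow (u v : ℝ) {t : ℝ} (ht : t ∈ Set.Icc (0 : ℝ) 1) :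
    ((t ^ (u - 1) * (1 - t) ^ (v - 1) : ℝ) : ℂ) =
      (t : ℂ) ^ ((u : ℂ) - 1) * (1 - (t : ℂ)) ^ ((v : ℂ) - 1) := by
  have h : 0 ≤ 1 - t := sub_nonneg.2 ht.2
  rw [Complex.ofReal_mul, Complex.ofReal_cpow ht.1, Complex.ofReal_cpow h]
  push_cast
  rfl

theorem intervalIntegrable_rpow_mul_one_sub_rpow {u v : ℝ} (hu : 0 < u) (hv : 0 < v) :
    IntervalIntegrable (fun t : ℝ => t ^ (u - 1) * (1 - t) ^ (v - 1))
      MeasureTheory.volume 0 1 := by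
  have h := Complex.betaIntegral_convergent (u := u) (v := v) (by simpa) (by simpa)
  rw [intervalIntegrable_iff_integrableOn_Ioc_of_le zero_le_one] at h ⊢
  refine MeasureTheory.IntegrableOn.congr_fun h.re (fun t ht => ?_) measurableSet_Ioc
  simp only [← ofReal_rpow_mul_one_sub_rpow u v (Set.Ioc_subset_Icc_self ht)]
  exact Complex.ofReal_re _

theorem integral_rpow_mul_one_sub_rpow {u v : ℝ} (hu : 0 < u) (hv : 0 < v) :
    ∫ t in (0 : ℝ)..1, t ^ (u - 1) * (1 - t) ^ (v - 1) =
      Real.Gamma u * Real.Gamma v / Real.Gamma (u + v) := by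
  apply Complex.ofReal_injective
  have h := Complex.betaIntegral_eq_Gamma_mul_div u v (by simpa) (by simpa)
  rw [← Complex.ofReal_add, Complex.Gamma_ofReal, Complex.Gamma_ofReal,
    Complex.Gamma_ofReal] at h
  push_cast
  rw [← h, Complex.betaIntegral, ← intervalIntegral.integral_ofReal]
  refine intervalIntegral.integral_congr fun t ht => ?_
  rw [Set.uIcc_of_le zero_le_one] at ht
  exact ofReal_rpow_mul_one_sub_rpow u v ht

/-- Bateman's integral representation (terminating case):
`∫₀¹ t^{c-1}(1-t)^{d-1} ₂F₁(-n,b;c;tx) dt = (Γ(c)Γ(d)/Γ(c+d)) ₂F₁(-n,b;c+d;x)`. -/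
theorem bateman_integral (n : ℕ) (b x : ℝ) (c d : ℝ) (hc : 0 < c) (hd : 0 < d) :
    ∫ t in (0 : ℝ)..1,
        t ^ (c - 1) * (1 - t) ^ (d - 1) *
          ∑ k ∈ Finset.range (n + 1),
            (poch (-(n : ℝ)) k * poch b k / (poch c k * (Nat.factorial k : ℝ))) * (t * x) ^ k =
      (Real.Gamma c * Real.Gamma d / Real.Gamma (c + d)) *
        ∑ k ∈ Finset.range (n + 1),
          (poch (-(n : ℝ)) k * poch b k / (poch (c + d) k * (Nat.factorial k : ℝ))) * x ^ k := by
  have hterm (a : ℕ → ℝ) (t : ℝ) (ht : t ∈ Set.Ioc (0 : ℝ) 1) :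
      t ^ (c - 1) * (1 - t) ^ (d - 1) * ∑ k ∈ Finset.range (n + 1), a k * (t * x) ^ k =
        ∑ k ∈ Finset.range (n + 1),
          a k * x ^ k * (t ^ (c + k - 1) * (1 - t) ^ (d - 1)) := by
    rw [Finset.mul_sum]
    refine Finset.sum_congr rfl fun k _ => ?_
    rw [add_sub_right_comm, Real.rpow_add_natCast ht.1.ne', mul_pow]
    ring
  rw [intervalIntegral.integral_congr_ae (Filter.Eventually.of_forall fun t ht =>
    hterm _ t (Set.uIoc_of_le (zero_le_one (α := ℝ)) ▸ ht)),
    intervalIntegral.integral_finsetSum fun k _ =>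
      (intervalIntegrable_rpow_mul_one_sub_rpow (by positivity) hd).const_mul _,
    Finset.mul_sum]
  refine Finset.sum_congr rfl fun k _ => ?_
  have hck := (poch_pos hc k).ne'
  have hcdk := (poch_pos (add_pos hc hd) k).ne'
  have hG := (Real.Gamma_pos_of_pos (add_pos hc hd)).ne'
  rw [intervalIntegral.integral_const_mul,
    integral_rpow_mul_one_sub_rpow (by positivity) hd, add_right_comm,
    Gamma_add_natCast_eq_poch_mul_Gamma hc,
    Gamma_add_natCast_eq_poch_mul_Gamma (add_pos hc hd)]
  field_simp
end
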